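/- Branching reduction: for all commands c and stores σ, ρ with ⊢{c}Γ, suppose ⟨c,σ⟩ →ε ⟨c'_σ,σ'⟩ and ⟨c,ρ⟩ →ε ⟨c'_ρ,ρ'⟩ with c'_σ ≠ c'_ρ. Then for every channel–program-point pair a_p such that ⟨c'_σ,σ'⟩ produces a channel-a trace t ending in an output (a,v,p) at program point p, if σ ≡_{Γ(a_p)} ρ then either (i) there exists a joining command c_j and a prefix t₁ of t with ⟨c'_σ,σ'⟩ ⇒t₁_a,* ⟨c_j,σ_j⟩ and ⟨c'_ρ,ρ'⟩ ⇒t'₁_a,* ⟨c_j,ρ_j⟩, |t₁| = |t'₁|, ⊢{c_j}Γ_j, and σ_j ≡_{Γ_j(a_p)} ρ_j; or (ii) every channel-a trace t' produced by ⟨c,ρ⟩ satisfies |t| ≥ |t'|. -/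

import Mathlib

/-- Program variables. -/
abbrev PVar := String
/-- Channels. -/
abbrev Chan := String
/-- Program points. -/
abbrev PPoint := String
/-- Values. -/
abbrev Val := ℤ
/-- Stores map program variables to values. -/
abbrev Store := PVar → Val

/-- Expressions: integer constants or variables. -/
inductive Expr where
  | const : Val → Expr
  | var : PVar → Expr
deriving DecidableEq

def Expr.eval : Expr → Store → Val
  | .const v, _ => v
  | .var x, σ => σ x

def Expr.fv : Expr → Set PVar
  | .const _ => ∅
  | .var x => {x}

/-- Commands of the while-language with annotated outputs. -/
inductive Cmd where
  | skip : Cmd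
  | seq : Cmd → Cmd → Cmd
  | assign : PVar → Expr → Cmd
  | ite : Expr → Cmd → Cmd → Cmd
  | while : Expr → Cmd → Cmd
  | out : Expr → Chan → PPoint → Cmd
deriving DecidableEq

/-- Step labels: silent, or an output (channel, value, program point). -/
inductive Label where
  | silent : Label
  | out : Chan → Val → PPoint → Label
deriving DecidableEq

abbrev Config := Cmd × Store

/-- Small-step semantics. -/
inductive Step : Config → Label → Config → Prop where
  | skipSeq : ∀ (c : Cmd) (σ : Store), Step (.seq .skip c, σ) .silent (c, σ)
  | seq : ∀ {c₁ : Cmd} {σ : Store} {α : Label} {c₁' : Cmd} {σ' : Store} (c₂ : Cmd),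
      Step (c₁, σ) α (c₁', σ') → Step (.seq c₁ c₂, σ) α (.seq c₁' c₂, σ')
  | assign : ∀ (x : PVar) (e : Expr) (σ : Store),
      Step (.assign x e, σ) .silent (.skip, Function.update σ x (e.eval σ))
  | out : ∀ (e : Expr) (a : Chan) (p : PPoint) (σ : Store),
      Step (.out e a p, σ) (.out a (e.eval σ) p) (.skip, σ)
  | whileStep : ∀ (e : Expr) (c : Cmd) (σ : Store),
      Step (.while e c, σ) .silent (.ite e (.seq c (.while e c)) .skip, σ)
  | iteTrue : ∀ {e : Expr} {σ : Store} (c₁ c₂ : Cmd),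
      e.eval σ ≠ 0 → Step (.ite e c₁ c₂, σ) .silent (c₁, σ)
  | iteFalse : ∀ {e : Expr} {σ : Store} (c₁ c₂ : Cmd),
      e.eval σ = 0 → Step (.ite e c₁ c₂, σ) .silent (c₂, σ)

/-- Prepend a label to a list of (output) labels, dropping silent labels. -/
def Label.consTo : Label → List Label → List Label
  | .silent, ls => ls
  | l, ls => l :: ls

/-- `Steps cfg ls n cfg'`: `n` evaluation steps from `cfg` to `cfg'`, producing
the list `ls` of output labels (silent steps contribute nothing). -/
inductive Steps : Config → List Label → ℕ → Config → Prop where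
  | refl : ∀ cfg, Steps cfg [] 0 cfg
  | step : ∀ {cfg : Config} {α : Label} {cfg' : Config} {ls : List Label} {n : ℕ} {cfg'' : Config},
      Step cfg α cfg' → Steps cfg' ls n cfg'' → Steps cfg (α.consTo ls) (n+1) cfg''

/-- Projection of a label list to the values output on channel `a`. -/
def projA (a : Chan) (ls : List Label) : List Val :=
  ls.filterMap fun l => match l with
    | .silent => none
    | .out b v _ => if b = a then some v else none

/-- `⟨c,σ⟩ ⇒t_a,n ⟨c',σ'⟩`: n steps producing trace `t` of values on channel `a`. -/
def ProjSteps (cfg : Config) (a : Chan) (t : List Val) (n : ℕ) (cfg' : Config) : Prop :=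
  ∃ ls, Steps cfg ls n cfg' ∧ projA a ls = t

/-- `⟨c,σ⟩ ⇒t_a`: the run of `c` from `σ` produces trace `t` on channel `a`. -/
def Produces (c : Cmd) (σ : Store) (a : Chan) (t : List Val) : Prop :=
  ∃ n cfg', ProjSteps (c, σ) a t n cfg'

/-- A forgetful attacker: a deterministic automaton over values. -/
structure Attacker (S : Type) where
  init : S
  step : S → Val → S

/-- The attacker's state after observing trace `t`. -/
def Attacker.run {S : Type} (A : Attacker S) (t : List Val) : S :=
  t.foldl A.step A.init

/-- The counting variant `A^ω` of an attacker. -/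
def Attacker.omega {S : Type} (A : Attacker S) : Attacker (S × ℕ) where
  init := (A.init, 0)
  step := fun sn v => (A.step sn.1 v, sn.2 + 1)

/-- Attacker knowledge `k(A,c,a,t)`. -/
def know {S : Type} (A : Attacker S) (c : Cmd) (a : Chan) (t : List Val) : Set Store :=
  { ρ | ∃ t', Produces c ρ a t' ∧ A.run t' = A.run t }

/-- Exclusion knowledge `ek(A,c,a,t)`. -/
def ek {S : Type} (A : Attacker S) (c : Cmd) (a : Chan) (t : List Val) : Set Store :=
  (know A c a t)ᶜ

/-- Full progress knowledge `k#(A,c,a,t)`. -/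
def kSharp {S : Type} (A : Attacker S) (c : Cmd) (a : Chan) (t : List Val) : Set Store :=
  { ρ | ∃ t' v, Produces c ρ a (t' ++ [v]) ∧ A.omega.run t' = A.omega.run t }

/-- Exclusion version `ek#(A,c,a,t)`. -/
def ekSharp {S : Type} (A : Attacker S) (c : Cmd) (a : Chan) (t : List Val) : Set Store :=
  (kSharp A c a t)ᶜ

/-- AC progress knowledge `k⁺(A,c,a,t)`. -/
def kPlus {S : Type} (A : Attacker S) (c : Cmd) (a : Chan) (t : List Val) : Set Store :=
  { ρ | ∃ t' v, Produces c ρ a (t' ++ [v]) ∧ A.run t' = A.run t }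

/-- Exclusion version `ek⁺(A,c,a,t)`. -/
def ekPlus {S : Type} (A : Attacker S) (c : Cmd) (a : Chan) (t : List Val) : Set Store :=
  (kPlus A c a t)ᶜ

/-- A dynamic policy: an equivalence relation on stores per channel and execution point. -/
structure DynPolicy where
  rel : Chan → Cmd → Store → ℕ → Store → Store → Prop
  isEquiv : ∀ a c σ n, Equivalence (rel a c σ n)

/-- Progress-insensitive security of `c` for policy `D` against attacker `A`
on channel `a` for initial store `σ`. -/
def PISecure {S : Type} (c : Cmd) (D : DynPolicy) (A : Attacker S) (a : Chan) (σ : Store) : Prop :=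
  ∀ t n c' σ' v, ProjSteps (c, σ) a t n (c', σ') →
    (∃ cfg', ProjSteps (c', σ') a [v] 1 cfg') →
    ek A c a (t ++ [v]) \ ekSharp A c a t ⊆ { ρ | ¬ D.rel a c σ n ρ σ }

/-- AC progress-insensitive security of `c` for policy `D` against attacker `A`
on channel `a` for initial store `σ`. -/
def ACPISecure {S : Type} (c : Cmd) (D : DynPolicy) (A : Attacker S) (a : Chan) (σ : Store) : Prop :=
  ∀ t n c' σ' v, ProjSteps (c, σ) a t n (c', σ') →
    (∃ cfg', ProjSteps (c', σ') a [v] 1 cfg') →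
    ek A c a (t ++ [v]) \ ekPlus A c a t ⊆ { ρ | ¬ D.rel a c σ n ρ σ }

/-- Two-run progress-insensitive security. -/
def TwoRunPISecure (c : Cmd) (D : DynPolicy) (a : Chan) (σ : Store) : Prop :=
  ∀ t n cn σn v, ProjSteps (c, σ) a t n (cn, σn) →
    (∃ cfg', ProjSteps (cn, σn) a [v] 1 cfg') →
    ∀ ρ t' v', D.rel a c σ n ρ σ → Produces c ρ a (t' ++ [v']) → t'.length = t.length →
      v' = v

/-- A counting attacker always remembers at least how many outputs it has seen. -/
def Attacker.Counting {S : Type} (A : Attacker S) : Prop :=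
  ∀ t t' : List Val, A.run t = A.run t' → t.length = t'.length

/-- A command is quasi-constant if, per channel, all its traces are prefixes of
one fixed (possibly infinite) trace. -/
def QuasiConstant (c : Cmd) : Prop :=
  ∀ a : Chan, ∃ u : ℕ → Val, ∀ σ t, Produces c σ a t →
    ∀ i : Fin t.length, t.get i = u i.val

/-- The variables of the dependency type system. -/
inductive TVar where
  | pvar : PVar → TVar
  | cpoint : Chan → PPoint → TVar
  | pc : TVar
  | chan : Chan → TVar
deriving DecidableEq

/-- Type environments. -/
abbrev Env := TVar → Set TVar

/-- The identity environment. -/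
def idEnv : Env := fun x => {x}

/-- Sequential composition of environments: `(Γ₂;Γ₁)(x) = ⋃_{y ∈ Γ₂(x)} Γ₁(y)`. -/
def envComp (Γ₂ Γ₁ : Env) : Env := fun x => ⋃ y ∈ Γ₂ x, Γ₁ y

/-- Pointwise union of environments. -/
def envUnion (Γ₁ Γ₂ : Env) : Env := fun x => Γ₁ x ∪ Γ₂ x

/-- Iterates of an environment. -/
def envIter (Γ : Env) : ℕ → Env
  | 0 => idEnv
  | n+1 => envComp (envIter Γ n) Γ

/-- The fixed point `Γ* = ⋃_{n≥0} Γⁿ`. -/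
def envStar (Γ : Env) : Env := fun x => ⋃ n, envIter Γ n x

/-- Free variables of an expression, as type-system variables. -/
def fvT (e : Expr) : Set TVar := TVar.pvar '' e.fv

/-- The dependency type system `⊢{c}Γ`. -/
inductive Typing : Cmd → Env → Prop where
  | skip : Typing .skip idEnv
  | assign : ∀ (x : PVar) (e : Expr),
      Typing (.assign x e) (Function.update idEnv (.pvar x) (fvT e ∪ {TVar.pc}))
  | seq : ∀ {c₁ : Cmd} {Γ₁ : Env} {c₂ : Cmd} {Γ₂ : Env},
      Typing c₁ Γ₁ → Typing c₂ Γ₂ → Typing (.seq c₁ c₂) (envComp Γ₂ Γ₁)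
  | ite : ∀ {e : Expr} {c₁ : Cmd} {Γ₁ : Env} {c₂ : Cmd} {Γ₂ : Env},
      Typing c₁ Γ₁ → Typing c₂ Γ₂ →
      Typing (.ite e c₁ c₂)
        (Function.update
          (envUnion (envComp Γ₁ (Function.update idEnv .pc ({TVar.pc} ∪ fvT e)))
                    (envComp Γ₂ (Function.update idEnv .pc ({TVar.pc} ∪ fvT e))))
          .pc {TVar.pc})
  | whileT : ∀ {e : Expr} {c : Cmd} {Γc : Env}, Typing c Γc →
      Typing (.while e c)
        (Function.update
          (envStar (envComp Γc (Function.update idEnv .pc ({TVar.pc} ∪ fvT e))))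
          .pc {TVar.pc})
  | out : ∀ (e : Expr) (a : Chan) (p : PPoint),
      Typing (.out e a p)
        (Function.update
          (Function.update idEnv (.cpoint a p)
            (fvT e ∪ {TVar.pc, TVar.chan a, TVar.cpoint a p}))
          (.chan a) {TVar.pc, TVar.chan a})

/-- `σ ≡_{Γ(x)} ρ`: the stores agree on all program variables in `Γ(x)`. -/
def eqG (Γ : Env) (x : TVar) (σ ρ : Store) : Prop :=
  ∀ y : PVar, TVar.pvar y ∈ Γ x → σ y = ρ y

/-- A dynamic policy approximation: an equivalence relation on stores per
channel–program-point pair. -/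
structure PolApprox where
  rel : Chan → PPoint → Store → Store → Prop
  isEquiv : ∀ a p, Equivalence (rel a p)

/-- `c : A` is a sound approximation of dynamic policy `D`. -/
def SoundApprox (c : Cmd) (A : PolApprox) (D : DynPolicy) : Prop :=
  ∀ σ n ls c' σ' a v p cfg'',
    Steps (c, σ) ls n (c', σ') → Step (c', σ') (.out a v p) cfg'' →
    ∀ ρ₁ ρ₂, D.rel a c σ n ρ₁ ρ₂ → A.rel a p ρ₁ ρ₂

/-- The type variables a command may modify. -/
def modsOf : Cmd → Set TVar
  | .skip => ∅
  | .seq c d => modsOf c ∪ modsOf d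
  | .assign x _ => {TVar.pvar x}
  | .ite _ c d => modsOf c ∪ modsOf d
  | .while _ c => modsOf c
  | .out _ a p => {TVar.chan a, TVar.cpoint a p}

/-- Sequential evaluation contexts. -/
def plug (c : Cmd) : List Cmd → Cmd
  | [] => c
  | d :: ds => .seq (plug c ds) d

theorem pc_not_mods (c : Cmd) : TVar.pc ∉ modsOf c := by
  induction c <;> simp_all [modsOf]

theorem mem_envComp {Γ₂ Γ₁ : Env} {x z : TVar} :
    z ∈ envComp Γ₂ Γ₁ x ↔ ∃ y ∈ Γ₂ x, z ∈ Γ₁ y := by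
  simp [envComp]

theorem envComp_assoc (A B C : Env) : envComp (envComp A B) C = envComp A (envComp B C) := by
  funext x
  ext z
  simp only [mem_envComp]
  constructor
  · rintro ⟨y, ⟨w, h1, h2⟩, h3⟩
    exact ⟨w, h1, y, h2, h3⟩
  · rintro ⟨w, h1, y, h2, h3⟩
    exact ⟨y, ⟨w, h1, h2⟩, h3⟩

theorem idEnv_comp (A : Env) : envComp idEnv A = A := by
  funext x
  ext z
  simp [mem_envComp, idEnv]

theorem mem_upd {Γ : Env} {e : Expr} {x z : TVar} (hz : z ∈ Γ x) :
    z ∈ envComp Γ (Function.update idEnv .pc ({TVar.pc} ∪ fvT e)) x := by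
  rw [mem_envComp]
  refine ⟨z, hz, ?_⟩
  by_cases h : z = .pc
  · subst h; simp
  · simp [Function.update_of_ne h, idEnv]

theorem mem_upd_fv {Γ : Env} {e : Expr} {x z : TVar} (hz : TVar.pc ∈ Γ x) (h : z ∈ fvT e) :
    z ∈ envComp Γ (Function.update idEnv .pc ({TVar.pc} ∪ fvT e)) x := by
  rw [mem_envComp]
  refine ⟨_, hz, ?_⟩
  simp [h]

theorem envStar_one {Γ : Env} {x z : TVar} (h : z ∈ Γ x) : z ∈ envStar Γ x := by
  simp only [envStar, Set.mem_iUnion]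
  refine ⟨1, ?_⟩
  simp only [envIter, idEnv_comp]
  exact h

theorem envStar_zero {Γ : Env} {x : TVar} : x ∈ envStar Γ x := by
  simp only [envStar, Set.mem_iUnion]
  exact ⟨0, by simp [envIter, idEnv]⟩

theorem typing_self {c : Cmd} {Γ : Env} (h : Typing c Γ) :
    ∀ x, (x ∉ modsOf c ∨ ∀ y, x ≠ .pvar y) → x ∈ Γ x := by
  induction h with
  | skip => intro x _; simp [idEnv]
  | assign y e =>
    intro x hx
    have : x ≠ .pvar y := by
      rcases hx with hx | hx
      · simpa [modsOf] using hx
      · exact hx y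
    simp [Function.update_of_ne this, idEnv]
  | seq _ _ ih1 ih2 =>
    intro x hx
    rw [mem_envComp]
    refine ⟨x, ih2 x ?_, ih1 x ?_⟩
    · rcases hx with hx | hx
      · left; intro h; exact hx (Or.inr h)
      · right; exact hx
    · rcases hx with hx | hx
      · left; intro h; exact hx (Or.inl h)
      · right; exact hx
  | ite _ _ ih1 ih2 =>
    intro x hx
    by_cases hpc : x = .pc
    · subst hpc; simp
    rw [Function.update_of_ne hpc]
    left
    apply mem_upd
    apply ih1
    rcases hx with hx | hx
    · left; intro h; exact hx (Or.inl h)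
    · right; exact hx
  | whileT _ _ =>
    intro x hx
    by_cases hpc : x = .pc
    · subst hpc; simp
    rw [Function.update_of_ne hpc]
    exact envStar_zero
  | out e a p =>
    intro x _
    by_cases h1 : x = .chan a
    · subst h1; simp
    rw [Function.update_of_ne h1]
    by_cases h2 : x = .cpoint a p
    · subst h2; simp
    rw [Function.update_of_ne h2]
    simp [idEnv]

theorem typing_pc {c : Cmd} {Γ : Env} (h : Typing c Γ) :
    ∀ x ∈ modsOf c, TVar.pc ∈ Γ x := by
  induction h with
  | skip => intro x hx; simp [modsOf] at hx
  | assign y e =>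
    intro x hx
    simp only [modsOf, Set.mem_singleton_iff] at hx
    subst hx; simp
  | @seq c₁ Γ₁ c₂ Γ₂ t1 t2 ih1 ih2 =>
    intro x hx
    rw [mem_envComp]
    by_cases h2 : x ∈ modsOf c₂
    · exact ⟨_, ih2 x h2, typing_self t1 _ (Or.inl (pc_not_mods _))⟩
    · rcases hx with hx | hx
      · exact ⟨x, typing_self t2 _ (Or.inl h2), ih1 x hx⟩
      · exact absurd hx h2
  | @ite e c₁ Γ₁ c₂ Γ₂ t1 t2 ih1 ih2 =>
    intro x hx
    have hpc : x ≠ .pc := by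
      rintro rfl; exact pc_not_mods _ hx
    rw [Function.update_of_ne hpc]
    rcases hx with hx | hx
    · left; exact mem_upd (ih1 x hx)
    · right; exact mem_upd (ih2 x hx)
  | @whileT e c Γc t ih =>
    intro x hx
    have hpc : x ≠ .pc := by
      rintro rfl; exact pc_not_mods _ hx
    rw [Function.update_of_ne hpc]
    exact envStar_one (mem_upd (ih x hx))
  | out e a p =>
    intro x hx
    simp only [modsOf, Set.mem_insert_iff, Set.mem_singleton_iff] at hx
    rcases hx with rfl | rfl
    · simp
    · rw [Function.update_of_ne (by simp)]; simp

theorem typing_chan {c : Cmd} {Γ : Env} (h : Typing c Γ) (a : Chan) (p : PPoint) :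
    TVar.cpoint a p ∈ modsOf c → TVar.chan a ∈ Γ (.cpoint a p) := by
  induction h with
  | skip => intro hx; simp [modsOf] at hx
  | assign y e => intro hx; simp [modsOf] at hx
  | @seq c₁ Γ₁ c₂ Γ₂ t1 t2 ih1 ih2 =>
    intro hx
    rw [mem_envComp]
    rcases hx with hx | hx
    · exact ⟨_, typing_self t2 _ (Or.inr (by simp)), ih1 hx⟩
    · exact ⟨_, ih2 hx, typing_self t1 _ (Or.inr (by simp))⟩
  | @ite e c₁ Γ₁ c₂ Γ₂ t1 t2 ih1 ih2 =>
    intro hx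
    rw [Function.update_of_ne (by simp)]
    rcases hx with hx | hx
    · left; exact mem_upd (ih1 hx)
    · right; exact mem_upd (ih2 hx)
  | @whileT e c Γc t ih =>
    intro hx
    rw [Function.update_of_ne (by simp)]
    exact envStar_one (mem_upd (ih hx))
  | out e b q =>
    intro hx
    simp only [modsOf, Set.mem_insert_iff, Set.mem_singleton_iff] at hx
    rcases hx with hx | hx
    · simp at hx
    · cases hx
      rw [Function.update_of_ne (by simp)]; simp

theorem typing_ite_fv {e : Expr} {b₁ b₂ : Cmd} {Γ : Env} (h : Typing (.ite e b₁ b₂) Γ)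
    {x : TVar} (hx : x ∈ modsOf (.ite e b₁ b₂)) : fvT e ⊆ Γ x := by
  have hpc : x ≠ .pc := by
    rintro rfl; exact pc_not_mods _ hx
  intro z hz
  cases h with
  | ite t1 t2 =>
    rw [Function.update_of_ne hpc]
    rcases hx with hx | hx
    · left; exact mem_upd_fv (typing_pc t1 x hx) hz
    · right; exact mem_upd_fv (typing_pc t2 x hx) hz

theorem typing_plug {c : Cmd} {ds : List Cmd} : ∀ {Γ : Env}, Typing (plug c ds) Γ →
    ∃ Γc Γr, Typing c Γc ∧ Typing (plug .skip ds) Γr ∧ Γ = envComp Γr Γc := by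
  induction ds with
  | nil => intro Γ h; exact ⟨Γ, idEnv, h, Typing.skip, (idEnv_comp _).symm⟩
  | cons d ds ih =>
    intro Γ h
    cases h with
    | seq t1 t2 =>
      obtain ⟨Γc, Γr, h1, h2, h3⟩ := ih t1
      refine ⟨Γc, _, h1, Typing.seq h2 t2, ?_⟩
      rw [h3, envComp_assoc]

theorem step_plug {b b' : Cmd} {s s' : Store} {α : Label} (h : Step (b, s) α (b', s'))
    (ds : List Cmd) : Step (plug b ds, s) α (plug b' ds, s') := by
  induction ds with
  | nil => exact h
  | cons d ds ih => exact Step.seq d ih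

theorem no_step_skip {s : Store} {α : Label} {cfg : Config} : ¬ Step (.skip, s) α cfg := by
  intro h; cases h

theorem plug_eq_skip {b : Cmd} {ds : List Cmd} (h : plug b ds = .skip) : b = .skip := by
  cases ds with
  | nil => exact h
  | cons d ds => simp [plug] at h

theorem step_plug_inv {b : Cmd} {s : Store} {α : Label} {ds : List Cmd} :
    ∀ {c' : Cmd} {s' : Store}, Step (plug b ds, s) α (c', s') →
    b = .skip ∨ ∃ b', Step (b, s) α (b', s') ∧ c' = plug b' ds := by
  induction ds with
  | nil => intro c' s' h; exact Or.inr ⟨c', h, rfl⟩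
  | cons d ds ih =>
    intro c' s' h
    by_cases hb : b = .skip
    · exact Or.inl hb
    right
    simp only [plug] at h
    generalize hq : plug b ds = q at h
    cases h with
    | skipSeq => exact absurd (plug_eq_skip hq) hb
    | seq _ h =>
      subst hq
      rcases ih h with h | ⟨b', h1, rfl⟩
      · exact absurd h hb
      · exact ⟨b', h1, rfl⟩

theorem consTo_append (α : Label) (l1 l2 : List Label) :
    α.consTo (l1 ++ l2) = α.consTo l1 ++ l2 := by
  cases α <;> rfl

theorem steps_plug {ds : List Cmd} : ∀ {n : ℕ} {b : Cmd} {s : Store} {ls : List Label},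
    ∀ {b' : Cmd} {s' : Store}, Steps (b, s) ls n (b', s') →
    Steps (plug b ds, s) ls n (plug b' ds, s') := by
  intro n
  induction n with
  | zero => intro b s ls b' s' h; cases h; exact Steps.refl _
  | succ n ih =>
    intro b s ls b' s' h
    cases h with
    | @step _ α cfg' ls n cfg'' h1 h2 =>
      obtain ⟨b1, s1⟩ := cfg'
      exact Steps.step (step_plug h1 ds) (ih h2)

theorem steps_plug_inv {ds : List Cmd} : ∀ {n : ℕ} {b : Cmd} {s : Store} {ls : List Label}
    {cfg : Config}, Steps (plug b ds, s) ls n cfg →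
    (∃ b' s', Steps (b, s) ls n (b', s') ∧ cfg = (plug b' ds, s')) ∨
    (∃ ls1 n1 s1 ls2 n2, Steps (b, s) ls1 n1 (.skip, s1) ∧ Steps (plug .skip ds, s1) ls2 n2 cfg ∧
      ls = ls1 ++ ls2) := by
  intro n
  induction n with
  | zero => intro b s ls cfg h; cases h; exact Or.inl ⟨b, s, Steps.refl _, rfl⟩
  | succ n ih =>
    intro b s ls cfg h
    by_cases hb : b = .skip
    · subst hb
      exact Or.inr ⟨[], 0, s, ls, n+1, Steps.refl _, h, rfl⟩
    cases h with
    | @step _ α cfg' ls n cfg'' h1 h2 =>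
      obtain ⟨c1, s1⟩ := cfg'
      rcases step_plug_inv h1 with h | ⟨b1, h3, rfl⟩
      · exact absurd h hb
      rcases ih h2 with ⟨b', s', h4, h5⟩ | ⟨ls1, n1, s2, ls2, n2, h4, h5, rfl⟩
      · exact Or.inl ⟨b', s', Steps.step h3 h4, h5⟩
      · exact Or.inr ⟨_, _, s2, ls2, n2, Steps.step h3 h4, h5, consTo_append _ _ _⟩

theorem step_mods {cfg cfg' : Config} {α : Label} (h : Step cfg α cfg') :
    modsOf cfg'.1 ⊆ modsOf cfg.1 ∧ (∀ x, TVar.pvar x ∉ modsOf cfg.1 → cfg'.2 x = cfg.2 x) ∧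
    (∀ a v p, α = .out a v p → TVar.chan a ∈ modsOf cfg.1 ∧ TVar.cpoint a p ∈ modsOf cfg.1) := by
  induction h with
  | skipSeq c σ => simp [modsOf]
  | seq c₂ _ ih =>
    obtain ⟨h1, h2, h3⟩ := ih
    refine ⟨?_, ?_, ?_⟩
    · exact Set.union_subset_union_left _ h1
    · intro x hx
      exact h2 x (fun h => hx (Or.inl h))
    · intro a v p h
      exact ⟨Or.inl (h3 a v p h).1, Or.inl (h3 a v p h).2⟩
  | assign x e σ =>
    refine ⟨by simp [modsOf], ?_, by simp⟩
    intro y hy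
    have : y ≠ x := by rintro rfl; exact hy (by simp [modsOf])
    simp [Function.update_of_ne this]
  | out e a p σ =>
    refine ⟨by simp [modsOf], by simp, ?_⟩
    intro b v q h
    cases h
    simp [modsOf]
  | whileStep e c σ => simp [modsOf]
  | iteTrue c₁ c₂ _ => simp [modsOf]
  | iteFalse c₁ c₂ _ => simp [modsOf]

theorem steps_mods {cfg cfg' : Config} {ls : List Label} {n : ℕ} (h : Steps cfg ls n cfg') :
    modsOf cfg'.1 ⊆ modsOf cfg.1 ∧ (∀ x, TVar.pvar x ∉ modsOf cfg.1 → cfg'.2 x = cfg.2 x) ∧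
    (∀ a, TVar.chan a ∉ modsOf cfg.1 → projA a ls = []) := by
  induction h with
  | refl cfg => simp [projA]
  | @step c0 α c1 ls n c2 hs _ ih =>
    obtain ⟨h1, h2, h3⟩ := ih
    obtain ⟨g1, g2, g3⟩ := step_mods hs
    refine ⟨h1.trans g1, ?_, ?_⟩
    · intro x hx
      rw [h2 x (fun h => hx (g1 h)), g2 x hx]
    · intro a ha
      have := h3 a (fun h => ha (g1 h))
      cases α with
      | silent => exact this
      | out b v p =>
        have hb : b ≠ a := by
          rintro rfl
          exact ha (g3 _ _ _ rfl).1
        simpa [Label.consTo, projA, hb] using this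

theorem branch_decomp : ∀ {c c1 c2 : Cmd} {σ ρ s1 s2 : Store},
    Step (c, σ) .silent (c1, s1) → Step (c, ρ) .silent (c2, s2) → c1 ≠ c2 →
    ∃ ds e b₁ b₂ b b', c = plug (.ite e b₁ b₂) ds ∧ c1 = plug b ds ∧ c2 = plug b' ds ∧
      s1 = σ ∧ s2 = ρ ∧ Step (.ite e b₁ b₂, σ) .silent (b, σ) ∧
      Step (.ite e b₁ b₂, ρ) .silent (b', ρ) ∧ e.eval σ ≠ e.eval ρ := by
  intro c
  induction c with
  | skip => intro _ _ _ _ _ _ h; cases h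
  | out e a p => intro _ _ _ _ _ _ h; cases h
  | assign x e => intro _ _ _ _ _ _ h h' hne; cases h; cases h'; exact absurd rfl hne
  | seq c d ih _ =>
    intro _ _ _ _ _ _ h h' hne
    cases h with
    | skipSeq =>
      cases h' with
      | skipSeq => exact absurd rfl hne
      | seq _ h => exact absurd h no_step_skip
    | seq _ h =>
      cases h' with
      | skipSeq => exact absurd h no_step_skip
      | seq _ h' =>
        obtain ⟨ds, e, b₁, b₂, b, b', rfl, rfl, rfl, h4⟩ := ih h h' (by rintro rfl; exact hne rfl)
        exact ⟨d :: ds, e, b₁, b₂, b, b', rfl, rfl, rfl, h4⟩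
  | ite e b₁ b₂ _ _ =>
    intro c1 c2 σ ρ s1 s2 h h' hne
    have hh := h
    have hh' := h'
    cases h with
    | iteTrue _ _ g =>
      cases h' with
      | iteTrue _ _ g' => exact absurd rfl hne
      | iteFalse _ _ g' =>
        exact ⟨[], e, _, _, _, _, rfl, rfl, rfl, rfl, rfl, hh, hh', fun q => g (q.trans g')⟩
    | iteFalse _ _ g =>
      cases h' with
      | iteFalse _ _ g' => exact absurd rfl hne
      | iteTrue _ _ g' =>
        exact ⟨[], e, _, _, _, _, rfl, rfl, rfl, rfl, rfl, hh, hh', fun q => g' (q.symm.trans g)⟩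
  | _ => intro _ _ _ _ _ _ h h' hne; cases h; cases h'; exact absurd rfl hne

theorem ite_step_det {e : Expr} {b₁ b₂ b : Cmd} {ρ : Store} {α : Label} {cfg : Config}
    (h : Step (.ite e b₁ b₂, ρ) .silent (b, ρ)) (h' : Step (.ite e b₁ b₂, ρ) α cfg) :
    α = .silent ∧ cfg = (b, ρ) := by
  cases h <;> cases h' <;> first | exact ⟨rfl, rfl⟩ | contradiction

theorem eval_eq_of_fv {e : Expr} {σ ρ : Store} {S : Set TVar} (h : fvT e ⊆ S)
    (hS : ∀ y : PVar, TVar.pvar y ∈ S → σ y = ρ y) : e.eval σ = e.eval ρ := by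
  cases e with
  | const v => rfl
  | var x => exact hS x (h ⟨x, by simp [Expr.fv], rfl⟩)

/-- branching reduction. -/
theorem branching_reduction {c cσ' cρ' : Cmd} {σ σ' ρ ρ' : Store} {Γ : Env}
    (hty : Typing c Γ)
    (hσ : Step (c, σ) .silent (cσ', σ')) (hρ : Step (c, ρ) .silent (cρ', ρ'))
    (hne : cσ' ≠ cρ') :
    ∀ (a : Chan) (p : PPoint) (t : List Val) (v : Val),
      (∃ (m : ℕ) (cfgm cfge : Config),
         ProjSteps (cσ', σ') a t m cfgm ∧ Step cfgm (.out a v p) cfge) →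
      eqG Γ (.cpoint a p) σ ρ →
      (∃ (cj : Cmd) (σj ρj : Store) (t₁ t₁' : List Val) (m₁ m₁' : ℕ) (Γj : Env),
         t₁ <+: t ∧
         ProjSteps (cσ', σ') a t₁ m₁ (cj, σj) ∧
         ProjSteps (cρ', ρ') a t₁' m₁' (cj, ρj) ∧
         t₁.length = t₁'.length ∧
         Typing cj Γj ∧ eqG Γj (.cpoint a p) σj ρj) ∨
      (∀ t' : List Val, Produces c ρ a t' → t'.length ≤ t.length) := by
  intro a p t v ⟨m, cfgm, cfge, ⟨ls, hls, hlt⟩, hout⟩ heq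
  obtain ⟨ds, e, b₁, b₂, b, b', rfl, rfl, rfl, hs1, hs2, hb, hb', hev⟩ := branch_decomp hσ hρ hne
  subst hs1 hs2
  obtain ⟨Γi, Γr, hti, htr, rfl⟩ := typing_plug hty
  -- nothing relevant to `a_p` is modified by the branches
  have key : ∀ x ∈ Γr (.cpoint a p), x ∉ modsOf (.ite e b₁ b₂) := by
    intro x hx hm
    refine hev (eval_eq_of_fv (typing_ite_fv hti hm) ?_)
    intro y hy
    exact heq y (mem_envComp.2 ⟨x, hx, hy⟩)
  have hself : TVar.cpoint a p ∈ Γr (.cpoint a p) := typing_self htr _ (Or.inr (by simp))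
  have hbm := (step_mods hb).1
  have hbm' := (step_mods hb').1
  rcases steps_plug_inv hls with ⟨b1, s1, h1, rfl⟩ | ⟨ls1, n1, s1, ls2, n2, h1, h2, rfl⟩
  · -- the output would occur inside the branch, or right at its end
    have hpl : TVar.cpoint a p ∈ modsOf b1 → False := fun h =>
      key _ hself (hbm ((steps_mods h1).1 h))
    obtain ⟨ce, se⟩ := cfge
    by_cases hsk : b1 = .skip
    · subst hsk
      exfalso
      have hno : ∀ (ds : List Cmd) (c' : Cmd), ¬ Step (plug .skip ds, s1) (.out a v p) (c', se) := by
        intro ds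
        induction ds with
        | nil => intro c' h; exact no_step_skip h
        | cons d ds ih =>
          intro c' h
          simp only [plug] at h
          generalize hq : plug .skip ds = q at h
          cases h with
          | seq _ h => subst hq; exact ih _ h
      exact hno _ _ hout
    · rcases step_plug_inv hout with h | ⟨b2, h, _⟩
      · exact absurd h hsk
      · exact (hpl ((step_mods h).2.2 _ _ _ rfl).2).elim
  · have hin : TVar.cpoint a p ∈ modsOf (plug .skip ds) :=
      (steps_mods h2).1 ((step_mods hout).2.2 _ _ _ rfl).2
    have hch : TVar.chan a ∉ modsOf (.ite e b₁ b₂) := key _ (typing_chan htr a p hin)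
    by_cases hterm : ∃ lsr nr sr, Steps (.ite e b₁ b₂, ρ') lsr nr (.skip, sr)
    · left
      obtain ⟨lsr, nr, sr, hr⟩ := hterm
      cases hr with
      | @step _ α cfg1 lsr nr _ g1 g2 =>
        obtain ⟨rfl, rfl⟩ := ite_step_det hb' g1
        refine ⟨plug .skip ds, s1, sr, [], [], n1, nr, Γr, List.nil_prefix,
          ⟨ls1, steps_plug h1, (steps_mods h1).2.2 a (fun h => hch (hbm h))⟩,
          ⟨lsr, steps_plug g2, (steps_mods g2).2.2 a (fun h => hch (hbm' h))⟩, rfl, htr, ?_⟩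
        intro y hy
        have hk := key _ hy
        have e1 : s1 y = σ' y := (steps_mods h1).2.1 y (fun h => hk (hbm h))
        have e2 : sr y = ρ' y := (steps_mods g2).2.1 y (fun h => hk (hbm' h))
        rw [e1, e2]
        exact heq y (mem_envComp.2 ⟨_, hy, typing_self hti _ (Or.inl hk)⟩)
    · right
      rintro t' ⟨n, cfg', ls', hs, rfl⟩
      rcases steps_plug_inv hs with ⟨b1, s3, h3, _⟩ | ⟨lsr, nr, sr, _, _, h3, _, _⟩
      · rw [(steps_mods h3).2.2 a hch]; simp
      · exact absurd ⟨lsr, nr, sr, h3⟩ hterm
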